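/- Let K be a linearly ordered field, let d ≤ N be positive integers, let X be a d×N matrix over K of full rank d, and let k be a non-negative integer with k ≠ 1. Then X represents a regular matroid if and only if there exists a d×N matrix X_k over K such that for every d-element subset I of the column indices: if Δ_I(X) = 0 then Δ_I(X_k) = 0, and otherwise |Δ_I(X_k)| = |Δ_I(X)|^k. -/

import Mathlib

/-- The maximal minor of a `d × N` matrix indexed by a `d`-element set `I` of column
indices: the determinant of the square submatrix consisting of the columns in `I`
(taken in increasing order). Junk value `0` if `I.card ≠ d`. -/
noncomputable def maxMinor {K : Type*} [CommRing K] {d N : ℕ}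
    (X : Matrix (Fin d) (Fin N) K) (I : Finset (Fin N)) : K :=
  if h : I.card = d then
    (X.submatrix id (fun j : Fin d => ((I.orderIsoOfFin h) j).val)).det
  else 0

/-- A matrix is totally unimodular if every square submatrix has determinant `0`, `1` or `-1`. -/
def IsTotUnimod {K : Type*} [CommRing K] {d N : ℕ} (A : Matrix (Fin d) (Fin N) K) : Prop :=
  ∀ (k : ℕ) (f : Fin k → Fin d) (g : Fin k → Fin N), Function.Injective f → Function.Injective g →
    (A.submatrix f g).det = 0 ∨ (A.submatrix f g).det = 1 ∨ (A.submatrix f g).det = -1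

/-- A `d × N` matrix of full rank `d` represents a regular matroid if there is a totally
unimodular matrix with the same pattern of vanishing maximal minors. -/
def RepresentsRegular {K : Type*} [CommRing K] {d N : ℕ} (X : Matrix (Fin d) (Fin N) K) : Prop :=
  ∃ A : Matrix (Fin d) (Fin N) K, IsTotUnimod A ∧
    ∀ I : Finset (Fin N), I.card = d → (maxMinor X I = 0 ↔ maxMinor A I = 0)

open Function

noncomputable def colMinor {K : Type*} [CommRing K] {d N : ℕ}
    (X : Matrix (Fin d) (Fin N) K) (f : Fin d → Fin N) : K := (X.submatrix id f).det

section basic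
variable {K : Type*} [Field K] {d N : ℕ} (X : Matrix (Fin d) (Fin N) K)

lemma colMinor_eq_zero {f : Fin d → Fin N} {i j : Fin d} (hij : i ≠ j) (h : f i = f j) :
    colMinor X f = 0 :=
  Matrix.det_zero_of_column_eq hij (fun k => by simp [h])

lemma colMinor_perm (f : Fin d → Fin N) (σ : Equiv.Perm (Fin d)) :
    colMinor X (f ∘ σ) = ((Equiv.Perm.sign σ : ℤ) : K) * colMinor X f := by
  have := Matrix.det_permute' σ (X.submatrix id f)
  simpa [colMinor, Matrix.submatrix_submatrix] using this

lemma colMinor_update (f : Fin d → Fin N) (i : Fin d) (j : Fin N) :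
    colMinor X (update f i j) = ((X.submatrix id f).updateCol i (fun l => X l j)).det := by
  unfold colMinor
  congr 1
  ext a b
  by_cases h : b = i
  · subst h; simp
  · simp [h]

lemma colMinor_exchange (f g : Fin d → Fin N) (i : Fin d) :
    colMinor X f * colMinor X g =
      ∑ p, colMinor X (update f p (g i)) * colMinor X (update g i (f p)) := by
  have h1 := Matrix.mulVec_cramer (X.submatrix id f) (fun l => X l (g i))
  have h2 : (X.submatrix id g).updateCol i (fun l => X l (g i)) = X.submatrix id g := by
    ext a b
    by_cases h : b = i
    · subst h; simp
    · simp [h]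
  have h3 : colMinor X f * colMinor X g =
      Matrix.cramer (X.submatrix id g) ((X.submatrix id f).det • (fun l => X l (g i))) i := by
    rw [map_smul, Pi.smul_apply, Matrix.cramer_apply, h2]; rfl
  rw [h3, ← h1]
  have h4 : (X.submatrix id f).mulVec (Matrix.cramer (X.submatrix id f) (fun l => X l (g i)))
      = ∑ p, colMinor X (update f p (g i)) • (fun l => X l (f p)) := by
    ext l
    simp only [Matrix.mulVec, dotProduct, Matrix.cramer_apply, Finset.sum_apply, Pi.smul_apply,
      colMinor_update, smul_eq_mul, Matrix.submatrix_apply, id]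
    exact Finset.sum_congr rfl fun _ _ => mul_comm _ _
  rw [h4, map_sum, Finset.sum_apply]
  refine Finset.sum_congr rfl fun p _ => ?_
  rw [map_smul, Pi.smul_apply, Matrix.cramer_apply, colMinor_update X g, smul_eq_mul]

lemma colMinor_plucker (f : Fin d → Fin N) {i i' : Fin d} (hi : i ≠ i') (j j' : Fin N) :
    colMinor X f * colMinor X (update (update f i j) i' j') =
      colMinor X (update f i j) * colMinor X (update f i' j') -
      colMinor X (update f i j') * colMinor X (update f i' j) := by
  rw [colMinor_exchange X f _ i', Finset.sum_eq_add i' i hi.symm]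
  · have e1 : update (update (update f i j) i' j') i' (f i') = update f i j := by
      ext x; simp only [update_apply]; split_ifs <;> simp_all
    have e2 : update (update (update f i j) i' j') i' (f i) =
        update f i' j ∘ (Equiv.swap i i') := by
      ext x; simp only [update_apply, comp, Equiv.swap_apply_def]; split_ifs <;> simp_all
    rw [e1, e2, colMinor_perm, Equiv.Perm.sign_swap hi]
    simp; ring
  · intro c _ hc
    rw [colMinor_eq_zero X (f := update (update (update f i j) i' j') i' (f c)) hc.1, mul_zero]
    simp [hc.1, hc.2]
  · simp
  · simp

lemma colMinor_scale (u : Fin d → K) (s : Fin N → K) (f : Fin d → Fin N) :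
    colMinor (Matrix.of fun i j => u i * X i j * s j) f =
      (∏ i, u i) * colMinor X f * ∏ i, s (f i) := by
  have : (Matrix.of fun i j => u i * X i j * s j).submatrix id f =
    Matrix.diagonal u * X.submatrix id f * Matrix.diagonal (fun i => s (f i)) := by
    ext a b; simp [Matrix.mul_diagonal, Matrix.diagonal_mul]
  simp [colMinor, this]

lemma colMinor_mul (g : Matrix (Fin d) (Fin d) K) (f : Fin d → Fin N) :
    colMinor (g * X) f = g.det * colMinor X f := by
  have : (g * X).submatrix id f = g * X.submatrix id f := by
    ext a b; simp [Matrix.mul_apply]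
  simp [colMinor, this]
end basic

/-- degenerate three-term relations -/
def Degen {K : Type*} [CommRing K] {d N : ℕ} (X : Matrix (Fin d) (Fin N) K) : Prop :=
  ∀ (f : Fin d → Fin N) (i i' : Fin d) (j j' : Fin N), i ≠ i' →
    colMinor X f ≠ 0 → colMinor X (update f i j) ≠ 0 → colMinor X (update f i' j') ≠ 0 →
    colMinor X (update f i j') ≠ 0 → colMinor X (update f i' j) ≠ 0 →
    colMinor X (update (update f i j) i' j') = 0

section ord
variable {K : Type*} [Field K] [LinearOrder K] [IsStrictOrderedRing K] {d N : ℕ}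
  (X : Matrix (Fin d) (Fin N) K)

lemma abs_colMinor_perm (f : Fin d → Fin N) (σ : Equiv.Perm (Fin d)) :
    |colMinor X (f ∘ σ)| = |colMinor X f| := by
  rw [colMinor_perm, abs_mul]
  rcases Int.units_eq_one_or (Equiv.Perm.sign σ) with h | h <;> simp [h]

variable {X}

lemma cycle_tight (hX : Degen X) (n : ℕ) : ∀ (f : Fin d → Fin N) (r : ℕ → Fin d) (c : ℕ → Fin N),
    colMinor X f ≠ 0 →
    (∀ a ≤ n + 1, |colMinor X (update f (r a) (c a))| = |colMinor X f|) →
    (∀ a ≤ n, |colMinor X (update f (r (a + 1)) (c a))| = |colMinor X f|) →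
    (∀ a ≤ n + 1, ∀ b ≤ n + 1, a ≠ b → a ≠ b + 1 → ¬ (a = 0 ∧ b = n + 1) →
      colMinor X (update f (r a) (c b)) = 0) →
    colMinor X (update f (r 0) (c (n + 1))) ≠ 0 →
    |colMinor X (update f (r 0) (c (n + 1)))| = |colMinor X f| := by
  induction n with
  | zero =>
    intro f r c hf h1 h2 h3 h4
    have n0 : |colMinor X f| ≠ 0 := abs_ne_zero.2 hf
    have a0 := h1 0 (by omega)
    have a1 := h1 1 (by omega)
    have a2 := h2 0 (by omega)
    simp only [zero_add] at a0 a1 a2 h4 ⊢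
    by_cases hr : r 0 = r 1
    · rw [hr, a1]
    have m0 : colMinor X (update f (r 0) (c 0)) ≠ 0 := abs_ne_zero.1 (a0 ▸ n0)
    have m1 : colMinor X (update f (r 1) (c 1)) ≠ 0 := abs_ne_zero.1 (a1 ▸ n0)
    have m2 : colMinor X (update f (r 1) (c 0)) ≠ 0 := abs_ne_zero.1 (a2 ▸ n0)
    have hz := hX f (r 0) (r 1) (c 0) (c 1) hr hf m0 m1 h4 m2
    have hp := colMinor_plucker X f hr (c 0) (c 1)
    rw [hz, mul_zero, eq_comm, sub_eq_zero] at hp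
    have := congrArg abs hp
    rw [abs_mul, abs_mul, a0, a1, a2] at this
    exact (mul_right_cancel₀ n0 this).symm
  | succ n ih =>
    intro f r c hf h1 h2 h3 h4
    have n0 : |colMinor X f| ≠ 0 := abs_ne_zero.2 hf
    have nn := h1 (n + 2) (by omega)
    have nm := h2 (n + 1) (by omega)
    have hne : ∀ a, a ≤ n + 1 → r a ≠ r (n + 2) := by
      intro a ha h
      rcases Nat.eq_zero_or_pos a with h0 | h0
      · subst h0
        have := h3 0 (by omega) (n + 1) (by omega) (by omega) (by omega) (by omega)
        rw [h] at this
        rw [this, abs_zero] at nm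
        exact n0 nm.symm
      · have := h3 a (by omega) (n + 2) (by omega) (by omega) (by omega) (by omega)
        rw [h] at this
        rw [this, abs_zero] at nn
        exact n0 nn.symm
    set f' := update f (r (n + 2)) (c (n + 2)) with hf'
    have hf'0 : colMinor X f' ≠ 0 := abs_ne_zero.1 (nn ▸ n0)
    -- entries after the pivot
    have piv : ∀ a ≤ n + 1, ∀ b ≤ n + 1, ¬ (a = 0 ∧ b = n + 1) →
        |colMinor X (update f' (r a) (c b))| = |colMinor X (update f (r a) (c b))| := by
      intro a ha b hb hab
      have hp := colMinor_plucker X f (hne a ha).symm (c (n + 2)) (c b)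
      have hz : colMinor X (update f (r (n + 2)) (c b)) *
          colMinor X (update f (r a) (c (n + 2))) = 0 := by
        by_cases hb' : b = n + 1
        · rw [h3 a (by omega) (n + 2) (by omega) (by omega) (by omega) (by omega), mul_zero]
        · rw [h3 (n + 2) (by omega) b (by omega) (by omega) (by omega) (by omega), zero_mul]
      rw [hz, sub_zero] at hp
      have := congrArg abs hp
      rw [abs_mul, abs_mul, nn] at this
      exact mul_left_cancel₀ n0 this
    have key : |colMinor X (update f' (r 0) (c (n + 1)))| =
        |colMinor X (update f (r 0) (c (n + 2)))| := by
      have hp := colMinor_plucker X f (hne 0 (by omega)).symm (c (n + 2)) (c (n + 1))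
      rw [h3 0 (by omega) (n + 1) (by omega) (by omega) (by omega) (by omega), mul_zero,
        zero_sub] at hp
      have := congrArg abs hp
      rw [abs_mul, abs_neg, abs_mul, nm] at this
      exact mul_left_cancel₀ n0 this
    have := ih f' r c hf'0 ?_ ?_ ?_ ?_
    · rw [key, nn] at this
      exact this
    · intro a ha
      rw [piv a ha a ha (by omega), nn, h1 a (by omega)]
    · intro a ha
      rw [piv (a + 1) (by omega) a (by omega) (by omega), nn, h2 a (by omega)]
    · intro a ha b hb x y z
      rw [← abs_eq_zero, piv a ha b hb z, h3 a (by omega) b (by omega) x y (by omega), abs_zero]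
    · rw [← abs_ne_zero, key, abs_ne_zero]
      exact h4

/-- One pivot step preserves unimodularity. -/
def Uni (X : Matrix (Fin d) (Fin N) K) (μ : K) (f : Fin d → Fin N) : Prop :=
  |colMinor X f| = μ ∧ ∀ i j, colMinor X (update f i j) ≠ 0 → |colMinor X (update f i j)| = μ

lemma Uni.step (hX : Degen X) {μ : K} (hμ : μ ≠ 0) {f : Fin d → Fin N} (h : Uni X μ f)
    (p : Fin d) (q : Fin N) (hpq : colMinor X (update f p q) ≠ 0) : Uni X μ (update f p q) := by
  refine ⟨h.2 p q hpq, fun i j hij => ?_⟩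
  by_cases hi : p = i
  · subst hi
    rw [update_idem] at hij ⊢
    exact h.2 _ _ hij
  have hf : colMinor X f ≠ 0 := abs_ne_zero.1 (h.1 ▸ hμ)
  have hp := colMinor_plucker X f hi q j
  have hdeg := hX f p i q j hi hf hpq
  by_cases h1 : colMinor X (update f i j) = 0
  · rw [h1, mul_zero, zero_sub] at hp
    have h0 := mul_ne_zero hf hij
    rw [hp, neg_ne_zero, mul_ne_zero_iff] at h0
    have := congrArg abs hp
    rw [abs_mul, abs_neg, abs_mul, h.1, h.2 _ _ h0.1, h.2 _ _ h0.2] at this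
    exact mul_left_cancel₀ hμ this
  · have hz : colMinor X (update f p j) * colMinor X (update f i q) = 0 := by
      by_contra hne
      rw [← ne_eq, mul_ne_zero_iff] at hne
      exact hij (hdeg h1 hne.1 hne.2)
    rw [hz, sub_zero] at hp
    have := congrArg abs hp
    rw [abs_mul, abs_mul, h.1, h.2 _ _ hpq, h.2 _ _ h1] at this
    exact mul_left_cancel₀ hμ this

lemma Uni.all (hX : Degen X) {μ : K} (hμ : μ ≠ 0) {f : Fin d → Fin N} (h : Uni X μ f)
    (g : Fin d → Fin N) (hg : colMinor X g ≠ 0) : |colMinor X g| = μ := by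
  have main : ∀ S : Finset (Fin d), ∃ (f' : Fin d → Fin N) (σ : Equiv.Perm (Fin d)),
      Uni X μ f' ∧ ∀ i ∈ S, f' (σ i) = g i := by
    intro S
    induction S using Finset.induction_on with
    | empty => exact ⟨f, 1, h, by simp⟩
    | insert i S hi ih =>
      obtain ⟨f', σ, hu, hs⟩ := ih
      have hf : colMinor X f' ≠ 0 := abs_ne_zero.1 (hu.1 ▸ hμ)
      have hne := mul_ne_zero hf hg
      rw [colMinor_exchange X f' g i] at hne
      obtain ⟨p, -, hp⟩ := Finset.exists_ne_zero_of_sum_ne_zero hne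
      rw [mul_ne_zero_iff] at hp
      have hpS : ∀ i' ∈ S, σ i' ≠ p := by
        intro i' hi' e
        have hii : i ≠ i' := fun e => hi (e ▸ hi')
        apply hp.2
        apply colMinor_eq_zero X hii
        rw [update_self, update_of_ne hii.symm, ← hs i' hi', e]
      refine ⟨update f' p (g i), σ.trans (Equiv.swap (σ i) p), hu.step hX hμ _ _ hp.1, ?_⟩
      intro i' hi'
      rcases Finset.mem_insert.1 hi' with e | e
      · subst e; simp
      · have h1 : σ i' ≠ σ i := fun e' => hi (σ.injective e' ▸ e)
        simp only [Equiv.trans_apply]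
        rw [Equiv.swap_apply_of_ne_of_ne h1 (hpS i' e), update_of_ne (hpS i' e), hs i' e]
  obtain ⟨f', σ, hu, hs⟩ := main Finset.univ
  have : g = f' ∘ σ := by ext i; simp [hs i]
  rw [this, abs_colMinor_perm, hu.1]

end ord

section graph

lemma shortest_sub {V : Type*} {G : SimpleGraph V} {u v : V} (p : G.Walk u v) (x n : ℕ) :
    G.Reachable (p.getVert x) (p.getVert (x + n)) ∧
    (x + n ≤ p.length → G.dist (p.getVert x) (p.getVert (x + n)) ≤ n) := by
  have e : (p.drop x).getVert n = p.getVert (x + n) := by simp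
  rw [← e]
  refine ⟨⟨(p.drop x).take n⟩, fun h => ?_⟩
  refine (SimpleGraph.dist_le ((p.drop x).take n)).trans ?_
  simp

lemma shortest_chord {V : Type*} {G : SimpleGraph V} {u v : V} (p : G.Walk u v)
    (hp : p.length = G.dist u v) {x y : ℕ} (hxy : x < y) (hy : y ≤ p.length)
    (h : G.Adj (p.getVert x) (p.getVert y)) : y = x + 1 := by
  have := SimpleGraph.dist_le (((p.take x).concat h).append (p.drop y))
  rw [← hp, SimpleGraph.Walk.length_append, SimpleGraph.Walk.length_concat] at this
  simp at this
  omega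

/-- bipartite graph of a relation -/
def bip {α β : Type*} (R : α → β → Prop) : SimpleGraph (α ⊕ β) where
  Adj x y := (∃ i j, x = Sum.inl i ∧ y = Sum.inr j ∧ R i j) ∨
    (∃ i j, y = Sum.inl i ∧ x = Sum.inr j ∧ R i j)
  symm := ⟨fun _ _ h => h.symm⟩
  loopless := ⟨by rintro x (⟨i, j, h, h', -⟩ | ⟨i, j, h, h', -⟩) <;> simp [h] at h'⟩

variable {α β : Type*} {R : α → β → Prop}

lemma bip_adj {i : α} {j : β} : (bip R).Adj (Sum.inl i) (Sum.inr j) ↔ R i j := by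
  simp [bip]

lemma bip_left {i : α} {y : α ⊕ β} (h : (bip R).Adj (Sum.inl i) y) : ∃ j, y = Sum.inr j := by
  rcases h with ⟨i', j, h1, h2, -⟩ | ⟨i', j, h1, h2, -⟩
  · exact ⟨j, h2⟩
  · simp at h2

lemma bip_right {j : β} {y : α ⊕ β} (h : (bip R).Adj (Sum.inr j) y) : ∃ i, y = Sum.inl i := by
  rcases h with ⟨i', j, h1, h2, -⟩ | ⟨i', j, h1, h2, -⟩
  · simp at h1
  · exact ⟨_, h1⟩

lemma bip_walk {i : α} {y : α ⊕ β} (p : (bip R).Walk (Sum.inl i) y) (a : ℕ) :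
    (2 * a ≤ p.length → ∃ r, p.getVert (2 * a) = Sum.inl r) ∧
    (2 * a + 1 ≤ p.length → ∃ c, p.getVert (2 * a + 1) = Sum.inr c) := by
  induction a with
  | zero =>
    refine ⟨fun _ => ⟨i, by simp⟩, fun h => ?_⟩
    have := p.adj_getVert_succ (i := 0) (by omega)
    rw [SimpleGraph.Walk.getVert_zero] at this
    exact bip_left this
  | succ a ih =>
    have h1 : 2 * (a + 1) ≤ p.length → ∃ r, p.getVert (2 * (a + 1)) = Sum.inl r := by
      intro h
      obtain ⟨c, hc⟩ := ih.2 (by omega)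
      have := p.adj_getVert_succ (i := 2 * a + 1) (by omega)
      rw [hc] at this
      exact bip_right this
    refine ⟨h1, fun h => ?_⟩
    obtain ⟨r, hr⟩ := h1 (by omega)
    have := p.adj_getVert_succ (i := 2 * (a + 1)) (by omega)
    rw [hr] at this
    exact bip_left this

end graph

section ord2
variable {K : Type*} [Field K] [LinearOrder K] [IsStrictOrderedRing K] {d N : ℕ}
  {X : Matrix (Fin d) (Fin N) K}

lemma tight_of_reachable (hX : Degen X) {b : Fin d → Fin N} (hb : colMinor X b ≠ 0) (L : ℕ) :
    ∀ i j, (bip fun i j => |colMinor X (update b i j)| = |colMinor X b|).Reachable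
      (Sum.inl i) (Sum.inr j) →
    (bip fun i j => |colMinor X (update b i j)| = |colMinor X b|).dist
      (Sum.inl i) (Sum.inr j) = L → colMinor X (update b i j) ≠ 0 →
    |colMinor X (update b i j)| = |colMinor X b| := by
  induction L using Nat.strong_induction_on with
  | _ L ih =>
  intro i j hr hL hne
  set G := bip fun i j => |colMinor X (update b i j)| = |colMinor X b| with hG
  obtain ⟨p, hp⟩ := hr.exists_walk_length_eq_dist
  have hend := p.getVert_length
  have hpL : p.length = L := hp.trans hL
  rw [hpL] at hend
  obtain ⟨n, hn | hn⟩ := Nat.even_or_odd' L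
  · obtain ⟨r, hr⟩ := (bip_walk p n).1 (by omega)
    rw [← hn, hend] at hr
    simp at hr
  have hrow : ∀ a, ∃ r, a ≤ n → p.getVert (2 * a) = Sum.inl r := fun a => by
    by_cases h : a ≤ n
    · obtain ⟨r, hr⟩ := (bip_walk p a).1 (by omega)
      exact ⟨r, fun _ => hr⟩
    · exact ⟨i, fun h' => absurd h' h⟩
  have hcol : ∀ a, ∃ c, a ≤ n → p.getVert (2 * a + 1) = Sum.inr c := fun a => by
    by_cases h : a ≤ n
    · obtain ⟨r, hr⟩ := (bip_walk p a).2 (by omega)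
      exact ⟨r, fun _ => hr⟩
    · exact ⟨j, fun h' => absurd h' h⟩
  choose r hr using hrow
  choose c hc using hcol
  have r0 : r 0 = i := by
    have := hr 0 (by omega)
    simpa using this.symm
  have cn : c n = j := by
    have := hc n le_rfl
    rw [← hn, hend] at this
    simpa using this.symm
  have t1 : ∀ a ≤ n, |colMinor X (update b (r a) (c a))| = |colMinor X b| := by
    intro a ha
    have := p.adj_getVert_succ (i := 2 * a) (by omega)
    rw [hr a ha, hc a ha] at this
    exact (bip_adj (R := fun i j => |colMinor X (update b i j)| = |colMinor X b|)).1 this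
  have t2 : ∀ a, a + 1 ≤ n → |colMinor X (update b (r (a + 1)) (c a))| = |colMinor X b| := by
    intro a ha
    have := p.adj_getVert_succ (i := 2 * a + 1) (by omega)
    rw [show 2 * a + 1 + 1 = 2 * (a + 1) by ring, hr _ ha, hc a (by omega)] at this
    exact (bip_adj (R := fun i j => |colMinor X (update b i j)| = |colMinor X b|)).1 this.symm
  rcases n with _ | n
  · have := t1 0 le_rfl
    rwa [r0, cn] at this
  rw [← r0, ← cn] at hne ⊢
  refine cycle_tight hX n b r c hb t1 (fun a ha => t2 a (by omega)) ?_ hne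
  intro a ha a' ha' h1 h2 h3
  by_contra hnz
  rcases Nat.lt_or_ge a a' with h | h
  · have hs := shortest_sub p (2 * a) (2 * a' + 1 - 2 * a)
    rw [show 2 * a + (2 * a' + 1 - 2 * a) = 2 * a' + 1 by omega, hr a ha, hc a' ha'] at hs
    have hd := hs.2 (by omega)
    have ht := ih _ (by omega) _ _ hs.1 rfl hnz
    have hadj : G.Adj (p.getVert (2 * a)) (p.getVert (2 * a' + 1)) := by
      rw [hr a ha, hc a' ha']; exact bip_adj.2 ht
    have := shortest_chord p hp (by omega) (by omega) hadj
    omega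
  · have hs := shortest_sub p (2 * a' + 1) (2 * a - (2 * a' + 1))
    rw [show 2 * a' + 1 + (2 * a - (2 * a' + 1)) = 2 * a by omega, hr a ha, hc a' ha'] at hs
    have hd := hs.2 (by omega)
    rw [SimpleGraph.dist_comm] at hd
    have ht := ih _ (by omega) _ _ hs.1.symm rfl hnz
    have hadj : G.Adj (p.getVert (2 * a' + 1)) (p.getVert (2 * a)) := by
      rw [hr a ha, hc a' ha']; exact ((bip_adj (R := fun i j => |colMinor X (update b i j)| = |colMinor X b|)).2 ht).symm
    have := shortest_chord p hp (by omega) (by omega) hadj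
    omega

lemma exists_potential (w : Fin d → Fin N → K) (hw : ∀ i j, 0 ≤ w i j) :
    ∃ φ : Fin d ⊕ Fin N → K, (∀ v, 0 < φ v) ∧
      (∀ i j, w i j = 1 → w i j * φ (Sum.inl i) * φ (Sum.inr j) = 1) ∧
      ∀ i j, w i j ≠ 0 → (bip fun i j => w i j * φ (Sum.inl i) * φ (Sum.inr j) = 1).Reachable
        (Sum.inl i) (Sum.inr j) := by
  classical
  have main : ∀ S : Finset (Fin d × Fin N), ∃ φ : Fin d ⊕ Fin N → K, (∀ v, 0 < φ v) ∧
      (∀ i j, w i j = 1 → w i j * φ (Sum.inl i) * φ (Sum.inr j) = 1) ∧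
      ∀ i j, (i, j) ∈ S → w i j ≠ 0 →
        (bip fun i j => w i j * φ (Sum.inl i) * φ (Sum.inr j) = 1).Reachable
        (Sum.inl i) (Sum.inr j) := by
    intro S
    induction S using Finset.induction_on with
    | empty => exact ⟨fun _ => 1, by simp, by simp, by simp⟩
    | insert e S _ ih =>
      obtain ⟨i₀, j₀⟩ := e
      obtain ⟨φ, h1, h2, h3⟩ := ih
      set G := bip fun i j => w i j * φ (Sum.inl i) * φ (Sum.inr j) = 1 with hG
      by_cases hcase : w i₀ j₀ ≠ 0 → G.Reachable (Sum.inl i₀) (Sum.inr j₀)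
      · refine ⟨φ, h1, h2, fun i j hij => ?_⟩
        rcases Finset.mem_insert.1 hij with e | e
        · simp only [Prod.mk.injEq] at e
          rw [e.1, e.2]; exact hcase
        · exact h3 i j e
      · push Not at hcase
        obtain ⟨hw0, hnr⟩ := hcase
        have hpos : 0 < w i₀ j₀ * φ (Sum.inl i₀) * φ (Sum.inr j₀) :=
          mul_pos (mul_pos (lt_of_le_of_ne (hw _ _) hw0.symm) (h1 _)) (h1 _)
        set l := w i₀ j₀ * φ (Sum.inl i₀) * φ (Sum.inr j₀) with hl
        let ψ : Fin d ⊕ Fin N → K := fun v =>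
          φ v * if G.Reachable (Sum.inl i₀) v then Sum.elim (fun _ => l⁻¹) (fun _ => l) v else 1
        have hψ : ∀ v, 0 < ψ v := by
          intro v
          refine mul_pos (h1 v) ?_
          split_ifs
          · rcases v with v | v
            · exact inv_pos.2 hpos
            · exact hpos
          · exact one_pos
        have keep : ∀ i j, w i j * φ (Sum.inl i) * φ (Sum.inr j) = 1 →
            w i j * ψ (Sum.inl i) * ψ (Sum.inr j) = 1 := by
          intro i j hij
          have hadj : G.Adj (Sum.inl i) (Sum.inr j) := bip_adj.2 hij
          have hiff : G.Reachable (Sum.inl i₀) (Sum.inl i) ↔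
              G.Reachable (Sum.inl i₀) (Sum.inr j) :=
            ⟨fun h => h.trans hadj.reachable, fun h => h.trans hadj.symm.reachable⟩
          simp only [ψ, hiff]
          split_ifs
          · simp only [Sum.elim_inl, Sum.elim_inr]
            rw [← hij]
            field_simp
          · simpa using hij
        have hle : G ≤ bip fun i j => w i j * ψ (Sum.inl i) * ψ (Sum.inr j) = 1 := by
          rintro x y (⟨i, j, hx, hy, h⟩ | ⟨i, j, hx, hy, h⟩)
          · exact Or.inl ⟨i, j, hx, hy, keep i j h⟩
          · exact Or.inr ⟨i, j, hx, hy, keep i j h⟩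
        refine ⟨ψ, hψ, fun i j h => keep i j (h2 i j h), fun i j hij hwij => ?_⟩
        rcases Finset.mem_insert.1 hij with e | e
        · simp only [Prod.mk.injEq] at e
          rw [e.1, e.2]
          apply SimpleGraph.Adj.reachable
          rw [bip_adj]
          simp only [ψ, hnr, SimpleGraph.Reachable.refl, if_true, if_false, Sum.elim_inl, mul_one]
          rw [show w i₀ j₀ * (φ (Sum.inl i₀) * l⁻¹) * φ (Sum.inr j₀) =
            (w i₀ j₀ * φ (Sum.inl i₀) * φ (Sum.inr j₀)) * l⁻¹ by ring, ← hl]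
          exact mul_inv_cancel₀ hpos.ne'
        · exact (h3 i j e hwij).mono hle
  obtain ⟨φ, h1, h2, h3⟩ := main Finset.univ
  exact ⟨φ, h1, h2, fun i j => h3 i j (Finset.mem_univ _)⟩

lemma key (hX : Degen X) {b : Fin d → Fin N} (hb : colMinor X b ≠ 0) :
    ∃ (s : Fin N → K) (μ : K), (∀ j, 0 < s j) ∧ 0 < μ ∧
      ∀ f, colMinor X f ≠ 0 → |colMinor X f| * ∏ i, s (f i) = μ := by
  have hb' : |colMinor X b| ≠ 0 := abs_ne_zero.2 hb
  obtain ⟨φ, h1, h2, h3⟩ := exists_potential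
    (fun i j => |colMinor X (update b i j)| / |colMinor X b|)
    (fun i j => div_nonneg (abs_nonneg _) (abs_nonneg _))
  set s : Fin N → K := fun j => φ (Sum.inr j) with hs
  have hs0 : ∀ j, 0 < s j := fun j => h1 _
  set X1 : Matrix (Fin d) (Fin N) K := Matrix.of fun i j => (fun _ => (1:K)) i * X i j * s j with hX1
  have hm : ∀ f, colMinor X1 f = colMinor X f * ∏ i, s (f i) := by
    intro f; rw [hX1, colMinor_scale]; simp
  have hpr : ∀ f : Fin d → Fin N, 0 < ∏ i, s (f i) := fun f => Finset.prod_pos fun i _ => hs0 _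
  have hz : ∀ f, colMinor X1 f = 0 ↔ colMinor X f = 0 := by
    intro f; rw [hm]; simp [(hpr f).ne']
  have hX1d : Degen X1 := by
    intro f i i' j j'
    simp only [ne_eq, hz]
    exact hX f i i' j j'
  have habs : ∀ f, |colMinor X1 f| = |colMinor X f| * ∏ i, s (f i) := by
    intro f; rw [hm, abs_mul, abs_of_pos (hpr f)]
  have hb1 : colMinor X1 b ≠ 0 := by rwa [ne_eq, hz]
  have hrow : ∀ i, φ (Sum.inl i) * s (b i) = 1 := by
    intro i
    have := h2 i (b i) (by simp [hb'])
    simpa [hb'] using this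
  have hupd : ∀ i j, (∏ l, s (update b i j l)) * s (b i) = (∏ l, s (b l)) * s j := by
    intro i j
    rw [← Finset.mul_prod_erase _ _ (Finset.mem_univ i),
      ← Finset.mul_prod_erase Finset.univ (fun l => s (b l)) (Finset.mem_univ i), update_self]
    have : ∏ x ∈ Finset.univ.erase i, s (update b i j x) =
        ∏ x ∈ Finset.univ.erase i, s (b x) :=
      Finset.prod_congr rfl fun x hx => by rw [update_of_ne (Finset.ne_of_mem_erase hx)]
    rw [this]; ring
  have htight : ∀ i j, (|colMinor X (update b i j)| / |colMinor X b| * φ (Sum.inl i) *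
      φ (Sum.inr j) = 1) = (|colMinor X1 (update b i j)| = |colMinor X1 b|) := by
    intro i j
    have e : |colMinor X1 (update b i j)| = |colMinor X1 b| * (|colMinor X (update b i j)| /
        |colMinor X b| * φ (Sum.inl i) * φ (Sum.inr j)) := by
      have hne := (hs0 (b i)).ne'
      apply mul_right_cancel₀ hne
      rw [habs, habs, mul_assoc, hupd i j]
      calc _ = |colMinor X (update b i j)| * ((∏ l, s (b l)) * s j) * (φ (Sum.inl i) * s (b i)) := by
              rw [hrow, mul_one]
        _ = _ := by
              have : φ (Sum.inr j) = s j := rfl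
              rw [this]; field_simp
    rw [e]
    apply propext
    constructor
    · intro h; rw [h, mul_one]
    · intro h; exact mul_left_cancel₀ (abs_ne_zero.2 hb1) (h.trans (mul_one _).symm)
  simp only [htight] at h3
  have hU : Uni X1 |colMinor X1 b| b := by
    refine ⟨rfl, fun i j hij => ?_⟩
    refine tight_of_reachable hX1d hb1 _ i j (h3 i j ?_) rfl hij
    rw [ne_eq, hz] at hij
    exact div_ne_zero (abs_ne_zero.2 hij) hb'
  refine ⟨s, |colMinor X1 b|, hs0, abs_pos.2 hb1, fun f hf => ?_⟩
  rw [← habs]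
  exact hU.all hX1d (abs_ne_zero.2 hb1) f (by rwa [ne_eq, hz])

lemma pow_superadd {x z : K} (hx : 0 < x) (hz : 0 < z) {k : ℕ} (hk : 2 ≤ k) :
    x ^ k + z ^ k < (x + z) ^ k := by
  induction k, hk using Nat.le_induction with
  | base => nlinarith [mul_pos hx hz]
  | succ k _ ih =>
    have h1 := pow_pos hx k
    have h2 := pow_pos hz k
    have h3 := mul_lt_mul_of_pos_right ih (add_pos hx hz)
    rw [pow_succ, pow_succ, pow_succ]
    nlinarith [mul_pos h1 hz, mul_pos h2 hx]

lemma num_contra {k : ℕ} (hk : k ≠ 1) {p q r p' q' r' : K} (hp : p ≠ 0) (hq : q ≠ 0) (hr : r ≠ 0)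
    (h : p = q - r) (h' : p' = q' - r') (ep : |p'| = |p| ^ k) (eq : |q'| = |q| ^ k)
    (er : |r'| = |r| ^ k) : False := by
  rcases Nat.lt_or_ge k 2 with h2 | h2
  · have : k = 0 := by omega
    subst this
    simp only [pow_zero] at ep eq er
    rcases eq_or_eq_neg_of_abs_eq ep with a | a <;> rcases eq_or_eq_neg_of_abs_eq eq with b | b <;>
    rcases eq_or_eq_neg_of_abs_eq er with c | c <;> rw [a, b, c] at h' <;> linarith
  · have t1 : |p'| ≤ |q'| + |r'| := h' ▸ abs_sub _ _
    have t2 : |q'| ≤ |p'| + |r'| := by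
      rw [show q' = p' + r' by rw [h']; ring]; exact abs_add_le _ _
    have t3 : |r'| ≤ |q'| + |p'| := by
      rw [show r' = q' - p' by rw [h']; ring]; exact abs_sub _ _
    have a1 := abs_pos.2 hp
    have a2 := abs_pos.2 hq
    have a3 := abs_pos.2 hr
    have cases : |p| = |q| + |r| ∨ |q| = |p| + |r| ∨ |r| = |q| + |p| := by
      rcases abs_cases p with ⟨h1, _⟩ | ⟨h1, _⟩ <;> rcases abs_cases q with ⟨h2, _⟩ | ⟨h2, _⟩ <;>
      rcases abs_cases r with ⟨h3, _⟩ | ⟨h3, _⟩ <;> rw [h1, h2, h3] <;>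
      first
      | (left; linarith)
      | (right; left; linarith)
      | (right; right; linarith)
    rcases cases with c | c | c
    · have := pow_superadd a2 a3 h2
      rw [← c, ← ep, ← eq, ← er] at this; linarith
    · have := pow_superadd a1 a3 h2
      rw [← c, ← ep, ← eq, ← er] at this; linarith
    · have := pow_superadd a2 a1 h2
      rw [← c, ← ep, ← eq, ← er] at this; linarith

lemma degen_of_pow {k : ℕ} (hk : k ≠ 1) {Y : Matrix (Fin d) (Fin N) K}
    (h : ∀ f, colMinor X f ≠ 0 → |colMinor Y f| = |colMinor X f| ^ k) : Degen X := by
  intro f i i' j j' hi h1 h2 h3 h4 h5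
  by_contra h6
  refine num_contra hk (mul_ne_zero h1 h6) (mul_ne_zero h2 h3) (mul_ne_zero h4 h5)
    (colMinor_plucker X f hi j j') (colMinor_plucker Y f hi j j') ?_ ?_ ?_
  · rw [abs_mul, abs_mul, mul_pow, h _ h1, h _ h6]
  · rw [abs_mul, abs_mul, mul_pow, h _ h2, h _ h3]
  · rw [abs_mul, abs_mul, mul_pow, h _ h4, h _ h5]

lemma totUnimod_of_std (A : Matrix (Fin d) (Fin N) K) (b : Fin d → Fin N)
    (hb : A.submatrix id b = 1) (h : ∀ f, colMinor A f ≠ 0 → |colMinor A f| = 1) :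
    IsTotUnimod A := by
  classical
  intro k f g hf _
  set p : Fin d → Prop := fun x => x ∈ Set.range f with hp
  let e : Fin k ≃ {x // p x} := Equiv.ofInjective f hf
  let F : Fin d → Fin N := fun x => if hx : p x then g (e.symm ⟨x, hx⟩) else b x
  have hFf : ∀ y, F (f y) = g y := by
    intro y
    have hy : p (f y) := ⟨y, rfl⟩
    have : e.symm ⟨f y, hy⟩ = y := by rw [Equiv.symm_apply_eq]; rfl
    simp only [F, hy, dif_pos, this]
  have hbe : ∀ x y, A x (b y) = if x = y then 1 else 0 := by
    intro x y
    have := congrFun (congrFun hb x) y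
    simpa [Matrix.one_apply] using this
  have hFn : ∀ y, ¬ p y → F y = b y := fun y hy => by simp only [F, hy, dif_neg, not_false_eq_true]
  have hdet := Matrix.twoBlockTriangular_det' (A.submatrix id F) p (by
    intro i hi j hj
    rw [Matrix.submatrix_apply, hFn j hj, id, hbe, if_neg]
    rintro rfl; exact hj hi)
  have e1 : (Matrix.toSquareBlockProp (A.submatrix id F) fun i => ¬ p i) = 1 := by
    ext x y
    rw [Matrix.toSquareBlockProp_def, Matrix.of_apply, Matrix.submatrix_apply, hFn y y.2, id, hbe,
      Matrix.one_apply]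
    simp [Subtype.ext_iff]
  have e2 : (Matrix.toSquareBlockProp (A.submatrix id F) p).det = (A.submatrix f g).det := by
    rw [← Matrix.det_submatrix_equiv_self e]
    congr 1
    ext x y
    simp only [Matrix.submatrix_apply, Matrix.toSquareBlockProp_def, Matrix.of_apply, id]
    have : ((e y : {x // p x}) : Fin d) = f y := rfl
    rw [this, hFf]
    rfl
  rw [e1, Matrix.det_one, mul_one] at hdet
  have hdet' : (A.submatrix id F).det = (A.submatrix f g).det := by
    rw [hdet, ← e2]
    congr!
  rw [← hdet']
  by_cases h0 : colMinor A F = 0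
  · exact Or.inl h0
  · right
    exact eq_or_eq_neg_of_abs_eq (h F h0)

lemma exists_maxMinor (f : Fin d → Fin N) (hf : Injective f) : ∃ I : Finset (Fin N), I.card = d ∧
    ∀ Y : Matrix (Fin d) (Fin N) K, |colMinor Y f| = |maxMinor Y I| := by
  classical
  have hc : (Finset.univ.image f).card = d := by
    rw [Finset.card_image_of_injective _ hf]; simp
  refine ⟨Finset.univ.image f, hc, fun Y => ?_⟩
  set o := (Finset.univ.image f).orderIsoOfFin hc with ho
  let σ : Fin d → Fin d := fun i => o.symm ⟨f i, by simp⟩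
  have hσ : Injective σ := by
    intro x y hxy
    have := o.symm.injective hxy
    exact hf (by simpa using this)
  let τ : Equiv.Perm (Fin d) := Equiv.ofBijective σ (Finite.injective_iff_bijective.1 hσ)
  have : f = (fun j => (o j).val) ∘ τ := by
    ext i
    simp [τ, σ]
  rw [this, abs_colMinor_perm, maxMinor]
  rw [dif_pos (by rw [← this]; exact hc)]
  unfold colMinor
  congr!

lemma maxMinor_eq (I : Finset (Fin N)) (hI : I.card = d) : ∃ f : Fin d → Fin N,
    ∀ Y : Matrix (Fin d) (Fin N) K, maxMinor Y I = colMinor Y f :=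
  ⟨fun j => ((I.orderIsoOfFin hI) j).val, fun Y => by rw [maxMinor, dif_pos hI]; rfl⟩

lemma colMinor_rel {k : ℕ} {Y : Matrix (Fin d) (Fin N) K}
    (h : ∀ I : Finset (Fin N), I.card = d →
        (maxMinor X I = 0 → maxMinor Y I = 0) ∧
        (maxMinor X I ≠ 0 → |maxMinor Y I| = |maxMinor X I| ^ k)) (f : Fin d → Fin N)
    (hf : colMinor X f ≠ 0) : |colMinor Y f| = |colMinor X f| ^ k := by
  have hinj : Injective f := by
    intro x y hxy
    by_contra hne
    exact hf (colMinor_eq_zero X hne hxy)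
  obtain ⟨I, hI, hIe⟩ := exists_maxMinor (K := K) f hinj
  rw [hIe, hIe]
  refine (h I hI).2 ?_
  rwa [← abs_ne_zero, ← hIe, abs_ne_zero]

lemma regular_of_degen (hX : Degen X) : RepresentsRegular X := by
  by_cases hb : ∃ b, colMinor X b ≠ 0
  · obtain ⟨b, hb⟩ := hb
    obtain ⟨s, μ, hs, hμ, h⟩ := key hX hb
    set X1 : Matrix (Fin d) (Fin N) K := Matrix.of fun i j => (fun _ => (1:K)) i * X i j * s j
      with hX1
    have hm : ∀ f, colMinor X1 f = colMinor X f * ∏ i, s (f i) := by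
      intro f; rw [hX1, colMinor_scale]; simp
    have hpr : ∀ f : Fin d → Fin N, 0 < ∏ i, s (f i) := fun f => Finset.prod_pos fun i _ => hs _
    have hb1 : colMinor X1 b ≠ 0 := by rw [hm]; exact mul_ne_zero hb (hpr b).ne'
    have hμ1 : ∀ f, colMinor X f ≠ 0 → |colMinor X1 f| = μ := fun f hf => by
      rw [hm, abs_mul, abs_of_pos (hpr f), h f hf]
    have hu : IsUnit (X1.submatrix id b).det := isUnit_iff_ne_zero.2 hb1
    set A := (X1.submatrix id b)⁻¹ * X1 with hA
    have hAm : ∀ f, colMinor A f = (colMinor X1 b)⁻¹ * colMinor X1 f := by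
      intro f
      rw [hA, colMinor_mul, Matrix.det_nonsing_inv, Ring.inverse_eq_inv']; rfl
    have hA0 : ∀ f, colMinor A f = 0 ↔ colMinor X f = 0 := by
      intro f; rw [hAm, hm f]; simp [hb1, (hpr f).ne']
    refine ⟨A, totUnimod_of_std A b ?_ ?_, ?_⟩
    · have : A.submatrix id b = (X1.submatrix id b)⁻¹ * X1.submatrix id b := by
        ext x y; simp [hA, Matrix.mul_apply]
      rw [this, Matrix.nonsing_inv_mul _ hu]
    · intro f hf
      rw [ne_eq, hA0] at hf
      rw [hAm, abs_mul, abs_inv, hμ1 b hb, hμ1 f hf, inv_mul_cancel₀ hμ.ne']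
    · intro I hI
      obtain ⟨f, hf⟩ := maxMinor_eq (K := K) I hI
      rw [hf, hf, hA0]
  · push Not at hb
    by_cases hd : d = 0
    · subst hd
      exact absurd (hb Fin.elim0) (by simp [colMinor])
    refine ⟨0, ?_, ?_⟩
    · intro k f g _ _
      rcases Nat.eq_zero_or_pos k with h | h
      · subst h; simp
      · left
        have : Nonempty (Fin k) := ⟨⟨0, h⟩⟩
        rw [Matrix.submatrix_zero]
        exact Matrix.det_zero
    · intro I hI
      obtain ⟨f, hf⟩ := maxMinor_eq (K := K) I hI
      rw [hf, hf, hb f]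
      have : Nonempty (Fin d) := ⟨⟨0, Nat.pos_of_ne_zero hd⟩⟩
      simp [colMinor, Matrix.det_zero]

lemma exists_pow_of_degen (hd : 0 < d) (hX : Degen X) (k : ℕ) :
    ∃ Y : Matrix (Fin d) (Fin N) K, ∀ f,
      (colMinor X f = 0 → colMinor Y f = 0) ∧
      (colMinor X f ≠ 0 → |colMinor Y f| = |colMinor X f| ^ k) := by
  by_cases hb : ∃ b, colMinor X b ≠ 0
  · obtain ⟨b, hb⟩ := hb
    obtain ⟨s, μ, hs, hμ, h⟩ := key hX hb
    refine ⟨Matrix.of fun i j => (update (fun _ => (1:K)) ⟨0, hd⟩ (μ ^ k / μ)) i * X i j *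
      (fun j => s j / s j ^ k) j, fun f => ?_⟩
    rw [colMinor_scale, Finset.prod_update_of_mem (Finset.mem_univ _)]
    have hpr : 0 < ∏ i, s (f i) := Finset.prod_pos fun i _ => hs _
    simp only [Finset.prod_const_one, mul_one, Finset.prod_div_distrib, Finset.prod_pow]
    refine ⟨fun h0 => by simp [h0], fun h0 => ?_⟩
    have a0 := abs_ne_zero.2 h0
    rw [abs_mul, abs_mul, abs_of_pos (div_pos (pow_pos hμ k) hμ),
      abs_of_pos (div_pos hpr (pow_pos hpr k)), ← h f h0, mul_pow]
    have := hpr.ne'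
    field_simp
  · push Not at hb
    refine ⟨X, fun f => ⟨fun h => h, fun h => absurd (hb f) h⟩⟩

end ord2

/-- **Theorem 1.1 (ordered field case).** For a full-rank `d × N` matrix `X` over a linearly
ordered field and a non-negative integer `k ≠ 1`, `X` represents a regular matroid iff
there is a matrix `X_k` with `|Δ_I(X_k)| = |Δ_I(X)|^k` (convention `0^0 = 0`). -/
theorem kth_power_plucker_iff_regular_ordered_field {K : Type*} [Field K] [LinearOrder K] [IsStrictOrderedRing K]
    (d N : ℕ) (hd : 0 < d) (hdN : d ≤ N)
    (X : Matrix (Fin d) (Fin N) K) (hX : X.rank = d)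
    (k : ℕ) (hk1 : k ≠ 1) :
    RepresentsRegular X ↔
      ∃ Xk : Matrix (Fin d) (Fin N) K, ∀ I : Finset (Fin N), I.card = d →
        (maxMinor X I = 0 → maxMinor Xk I = 0) ∧
        (maxMinor X I ≠ 0 → |maxMinor Xk I| = |maxMinor X I| ^ k) := by
  constructor
  · rintro ⟨A, hA, hI⟩
    have hdeg : Degen X := by
      refine degen_of_pow (k := 0) (by norm_num) (Y := A) (colMinor_rel fun I hc => ?_)
      refine ⟨(hI I hc).1, fun h => ?_⟩
      have h0 : maxMinor A I ≠ 0 := fun e => h ((hI I hc).2 e)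
      rw [maxMinor, dif_pos hc] at h0 ⊢
      have := hA d id (fun j => ((I.orderIsoOfFin hc) j).val) Function.injective_id
        (fun x y hxy => (I.orderIsoOfFin hc).injective (Subtype.ext hxy))
      rcases this with e | e | e
      · exact absurd e h0
      · rw [e]; simp
      · rw [e]; simp
    obtain ⟨Y, hY⟩ := exists_pow_of_degen hd hdeg k
    refine ⟨Y, fun I hc => ?_⟩
    obtain ⟨f, hf⟩ := maxMinor_eq (K := K) I hc
    rw [hf, hf]
    exact hY f
  · rintro ⟨Y, hY⟩
    exact regular_of_degen (degen_of_pow hk1 (colMinor_rel hY))
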